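/- Let I₁ and I₂ be compatible complex structures with I₂ ≠ ±I₁, and let U₁, U₂ be strictly orthogonal pure finite-dimensional subspaces of V with I₁(U₁) = U₁ and I₂(U₂) = U₂. Let T = X + Y with X ∈ U₁, Y ∈ U₂ and T ≠ 0, and suppose Ĩ is a compatible complex structure with Ĩ(T) ∈ U₁ + U₂. Then either (Ĩ = I₁ or Ĩ = −I₁) and Y = 0, or (Ĩ = I₂ or Ĩ = −I₂) and X = 0. (The orthogonal sum of a pair of pure complex subspaces by different structures contains no other complex subspace.) -/

import Mathlib

open RealInnerProductSpace Module Submodule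

theorem aux_cramer {M : Type*} [AddCommGroup M] [Module ℝ M] (N : Submodule ℝ M)
    (a b c p q r : ℝ) (x y z : M)
    (hD : (b*r-c*q)^2+(c*p-a*r)^2+(a*q-b*p)^2 ≠ 0)
    (h1 : a • x + b • y + c • z ∈ N) (h2 : p • x + q • y + r • z ∈ N)
    (h3 : (b*r-c*q) • x + (c*p-a*r) • y + (a*q-b*p) • z ∈ N) :
    x ∈ N ∧ y ∈ N ∧ z ∈ N := by
  have key : ∀ (w : M) (s t n : ℝ),
      ((b*r-c*q)^2+(c*p-a*r)^2+(a*q-b*p)^2) • w = s • (a • x + b • y + c • z)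
        + t • (p • x + q • y + r • z)
        + n • ((b*r-c*q) • x + (c*p-a*r) • y + (a*q-b*p) • z) → w ∈ N := by
    intro w s t n h
    rw [← N.smul_mem_iff hD, h]
    exact N.add_mem (N.add_mem (N.smul_mem _ h1) (N.smul_mem _ h2)) (N.smul_mem _ h3)
  refine ⟨key x (q*(a*q-b*p) - r*(c*p-a*r)) ((c*p-a*r)*c-(a*q-b*p)*b) (b*r-c*q) ?_,
    key y (r*(b*r-c*q)-p*(a*q-b*p)) ((a*q-b*p)*a-(b*r-c*q)*c) (c*p-a*r) ?_,
    key z (p*(c*p-a*r)-q*(b*r-c*q)) ((b*r-c*q)*b-(c*p-a*r)*a) (a*q-b*p) ?_⟩ <;> module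

theorem aux_det (a b c p q r : ℝ) (h1 : a^2+b^2+c^2=1) (h2 : p^2+q^2+r^2=1)
    (hD : (b*r-c*q)^2+(c*p-a*r)^2+(a*q-b*p)^2 = 0) :
    (p = a ∧ q = b ∧ r = c) ∨ (p = -a ∧ q = -b ∧ r = -c) := by
  have hd : (a*p+b*q+c*r-1)*(a*p+b*q+c*r+1) = 0 := by
    linear_combination -hD + (p^2+q^2+r^2)*h1 + h2
  rcases mul_eq_zero.1 hd with h | h
  · left
    have : (p-a)^2+(q-b)^2+(r-c)^2 = 0 := by linear_combination h1 + h2 - 2*h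
    refine ⟨?_, ?_, ?_⟩ <;> nlinarith [sq_nonneg (p-a), sq_nonneg (q-b), sq_nonneg (r-c)]
  · right
    have : (p+a)^2+(q+b)^2+(r+c)^2 = 0 := by linear_combination h1 + h2 + 2*h
    refine ⟨?_, ?_, ?_⟩ <;> nlinarith [sq_nonneg (p+a), sq_nonneg (q+b), sq_nonneg (r+c)]

theorem aux_map {V : Type*} [AddCommGroup V] [Module ℝ V] (A : V →ₗ[ℝ] V)
    (h : ∀ x, A (A x) = -x) (S : Submodule ℝ V) (hS : ∀ x ∈ S, A x ∈ S) : S.map A = S := by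
  apply le_antisymm
  · rintro _ ⟨x, hx, rfl⟩
    exact hS x hx
  · intro x hx
    exact ⟨-(A x), S.neg_mem (hS x hx), by simp [h]⟩

theorem aux_comp {V : Type*} [AddCommGroup V] [Module ℝ V]
    (I J K : V →ₗ[ℝ] V)
    (hII : ∀ x, I (I x) = -x) (hJJ : ∀ x, J (J x) = -x) (hKK : ∀ x, K (K x) = -x)
    (hIJ : ∀ x, I (J x) = K x) (hJI : ∀ x, J (I x) = -K x) :
    (∀ x, J (K x) = I x) ∧ (∀ x, K (J x) = -I x) ∧ (∀ x, K (I x) = J x) ∧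
    (∀ x, I (K x) = -J x) := by
  refine ⟨fun x => ?_, fun x => ?_, fun x => ?_, fun x => ?_⟩
  · have := hJI (J x)
    rw [hIJ] at this
    rw [this, ← hIJ, hJJ]; simp
  · rw [← hIJ, hJJ]; simp
  · have := hJI (I x)
    rw [hII] at this
    simpa using this.symm
  · rw [← hIJ, hII]

theorem aux_prod {V : Type*} [AddCommGroup V] [Module ℝ V]
    (I J K : V →ₗ[ℝ] V)
    (hII : ∀ x, I (I x) = -x) (hJJ : ∀ x, J (J x) = -x) (hKK : ∀ x, K (K x) = -x)
    (hIJ : ∀ x, I (J x) = K x) (hJI : ∀ x, J (I x) = -K x) (a b c p q r : ℝ) (x : V) :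
    (a • I + b • J + c • K) ((p • I + q • J + r • K) x) = -(a*p+b*q+c*r) • x +
      ((b*r-c*q) • I x + (c*p-a*r) • J x + (a*q-b*p) • K x) := by
  obtain ⟨hJK, hKJ, hKI, hIK⟩ := aux_comp I J K hII hJJ hKK hIJ hJI
  simp only [LinearMap.add_apply, LinearMap.smul_apply, map_add, map_smul, hII, hJJ, hKK, hIJ, hJI,
    hJK, hKJ, hKI, hIK]
  module

theorem aux_pure {V : Type*} [AddCommGroup V] [Module ℝ V]
    (I J K : V →ₗ[ℝ] V)
    (hII : ∀ x, I (I x) = -x) (hJJ : ∀ x, J (J x) = -x) (hKK : ∀ x, K (K x) = -x)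
    (hIJ : ∀ x, I (J x) = K x) (hJI : ∀ x, J (I x) = -K x)
    (A B : V →ₗ[ℝ] V)
    (hA : ∃ a b c : ℝ, a ^ 2 + b ^ 2 + c ^ 2 = 1 ∧ A = a • I + b • J + c • K)
    (hB : ∃ a b c : ℝ, a ^ 2 + b ^ 2 + c ^ 2 = 1 ∧ B = a • I + b • J + c • K)
    (U : Submodule ℝ V) (hU : ∀ x ∈ U, A x ∈ U)
    (hpure : ∀ S : Submodule ℝ V, S ≤ U →
      S.map I = S → S.map J = S → S.map K = S → S = ⊥)
    (X : V) (hX : X ∈ U) (hX0 : X ≠ 0) (hBX : B X ∈ U) : B = A ∨ B = -A := by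
  obtain ⟨hJK, hKJ, hKI, hIK⟩ := aux_comp I J K hII hJJ hKK hIJ hJI
  obtain ⟨a, b, c, h1, rfl⟩ := hA
  obtain ⟨p, q, r, h2, rfl⟩ := hB
  by_cases hD : (b*r-c*q)^2+(c*p-a*r)^2+(a*q-b*p)^2 = 0
  · rcases aux_det a b c p q r h1 h2 hD with ⟨rfl, rfl, rfl⟩ | ⟨rfl, rfl, rfl⟩
    · left; rfl
    · right; module
  exfalso
  have h3 := hU _ hBX
  rw [aux_prod I J K hII hJJ hKK hIJ hJI,
    U.add_mem_iff_right (U.smul_mem _ hX)] at h3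
  obtain ⟨hi, hj, hk⟩ := aux_cramer U a b c p q r (I X) (J X) (K X) hD
    (by simpa using hU X hX) (by simpa using hBX) h3
  let S : Submodule ℝ V := span ℝ {X, I X, J X, K X}
  have m0 : X ∈ S := subset_span (by simp)
  have m1 : I X ∈ S := subset_span (by simp)
  have m2 : J X ∈ S := subset_span (by simp)
  have m3 : K X ∈ S := subset_span (by simp)
  have inv : ∀ C : V →ₗ[ℝ] V, C X ∈ S → C (I X) ∈ S → C (J X) ∈ S → C (K X) ∈ S →
      ∀ x ∈ S, C x ∈ S := by
    intro C k0 k1 k2 k3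
    have : S ≤ S.comap C := by
      apply span_le.2
      rintro y (rfl | rfl | rfl | rfl) <;> assumption
    exact fun x hx => this hx
  have hS : S = ⊥ := by
    apply hpure S
    · apply span_le.2
      rintro y (rfl | rfl | rfl | rfl) <;> assumption
    · apply aux_map I hII
      apply inv <;> simp [*]
    · apply aux_map J hJJ
      apply inv <;> simp [*]
    · apply aux_map K hKK
      apply inv <;> simp [*]
  rw [hS] at m0
  exact hX0 (by simpa using m0)

/-- The orthogonal sum of a pair of pure complex subspaces by different (up to
sign) compatible complex structures contains no other complex subspace. -/
theorem stmt_17 {V : Type*} [NormedAddCommGroup V] [InnerProductSpace ℝ V]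
    [FiniteDimensional ℝ V]
    (I J K : V →ₗ[ℝ] V)
    (hII : ∀ x, I (I x) = -x) (hJJ : ∀ x, J (J x) = -x) (hKK : ∀ x, K (K x) = -x)
    (hIJ : ∀ x, I (J x) = K x) (hJI : ∀ x, J (I x) = -K x)
    (hIsk : ∀ x y, ⟪I x, y⟫ = -⟪x, I y⟫)
    (hJsk : ∀ x y, ⟪J x, y⟫ = -⟪x, J y⟫)
    (hKsk : ∀ x y, ⟪K x, y⟫ = -⟪x, K y⟫)
    (I₁ I₂ It : V →ₗ[ℝ] V)
    (hI₁ : ∃ a b c : ℝ, a ^ 2 + b ^ 2 + c ^ 2 = 1 ∧ I₁ = a • I + b • J + c • K)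
    (hI₂ : ∃ a b c : ℝ, a ^ 2 + b ^ 2 + c ^ 2 = 1 ∧ I₂ = a • I + b • J + c • K)
    (hIt : ∃ a b c : ℝ, a ^ 2 + b ^ 2 + c ^ 2 = 1 ∧ It = a • I + b • J + c • K)
    (hne : I₂ ≠ I₁) (hne' : I₂ ≠ -I₁)
    (U₁ U₂ : Submodule ℝ V)
    (hU₁ : U₁.map I₁ = U₁) (hU₂ : U₂.map I₂ = U₂)
    (hpure₁ : ∀ S : Submodule ℝ V, S ≤ U₁ →
      S.map I = S → S.map J = S → S.map K = S → S = ⊥)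
    (hpure₂ : ∀ S : Submodule ℝ V, S ≤ U₂ →
      S.map I = S → S.map J = S → S.map K = S → S = ⊥)
    (horth : ∀ x ∈ U₁, ∀ y ∈ U₂, ⟪x, y⟫ = 0)
    (X Y : V) (hX : X ∈ U₁) (hY : Y ∈ U₂)
    (T : V) (hT : T = X + Y) (hT0 : T ≠ 0)
    (hItT : It T ∈ U₁ ⊔ U₂) :
    ((It = I₁ ∨ It = -I₁) ∧ Y = 0) ∨ ((It = I₂ ∨ It = -I₂) ∧ X = 0) := by
  have hU₁' : ∀ x ∈ U₁, I₁ x ∈ U₁ := fun x hx => hU₁ ▸ Submodule.mem_map_of_mem hx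
  have hU₂' : ∀ x ∈ U₂, I₂ x ∈ U₂ := fun x hx => hU₂ ▸ Submodule.mem_map_of_mem hx
  have skew : ∀ A : V →ₗ[ℝ] V, (∃ a b c : ℝ, a ^ 2 + b ^ 2 + c ^ 2 = 1 ∧
      A = a • I + b • J + c • K) → ∀ x y, ⟪A x, y⟫ = -⟪x, A y⟫ := by
    rintro _ ⟨a, b, c, -, rfl⟩ x y
    simp only [LinearMap.add_apply, LinearMap.smul_apply, inner_add_left, inner_add_right,
      real_inner_smul_left, real_inner_smul_right, hIsk, hJsk, hKsk]
    ring
  have sq : ∀ A : V →ₗ[ℝ] V, (∃ a b c : ℝ, a ^ 2 + b ^ 2 + c ^ 2 = 1 ∧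
      A = a • I + b • J + c • K) → ∀ x, A (A x) = -x := by
    rintro _ ⟨a, b, c, h, rfl⟩ x
    rw [aux_prod I J K hII hJJ hKK hIJ hJI]
    have : a*a+b*b+c*c = 1 := by linarith
    rw [this]
    module
  have cross : ∀ x ∈ U₁, ∀ y ∈ U₂, ⟪I x, y⟫ = 0 ∧ ⟪J x, y⟫ = 0 ∧ ⟪K x, y⟫ = 0 := by
    intro x hx y hy
    have e1 : ⟪I₁ x, y⟫ = 0 := horth _ (hU₁' x hx) y hy
    have e2 : ⟪I₂ x, y⟫ = 0 := by
      rw [skew I₂ hI₂, horth x hx _ (hU₂' y hy), neg_zero]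
    have e3 : ⟪I₂ (I₁ x), y⟫ = 0 := by
      rw [skew I₂ hI₂, horth _ (hU₁' x hx) _ (hU₂' y hy), neg_zero]
    obtain ⟨a, b, c, h1, rfl⟩ := hI₁
    obtain ⟨p, q, r, h2, rfl⟩ := hI₂
    have hD : (q*c-r*b)^2+(r*a-p*c)^2+(p*b-q*a)^2 ≠ 0 := by
      intro hD
      rcases aux_det p q r a b c h2 h1 hD with ⟨rfl, rfl, rfl⟩ | ⟨rfl, rfl, rfl⟩
      · exact hne rfl
      · exact hne' (by module)
    rw [aux_prod I J K hII hJJ hKK hIJ hJI] at e3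
    simp only [LinearMap.add_apply, LinearMap.smul_apply, inner_add_left,
      real_inner_smul_left, horth x hx y hy, mul_zero, zero_add] at e1 e2 e3
    have := aux_cramer (⊥ : Submodule ℝ ℝ) p q r a b c ⟪I x, y⟫ ⟪J x, y⟫ ⟪K x, y⟫ hD
      (by simpa using e2) (by simpa using e1) (by simpa using e3)
    simpa using this
  have crossT : ∀ x ∈ U₁, ∀ y ∈ U₂, ⟪It x, y⟫ = 0 := by
    intro x hx y hy
    obtain ⟨p, q, r, -, rfl⟩ := hIt
    obtain ⟨k1, k2, k3⟩ := cross x hx y hy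
    simp [inner_add_left, real_inner_smul_left, k1, k2, k3]
  obtain ⟨Z, hZ, W, hW, hZW⟩ := Submodule.mem_sup.1 hItT
  rw [hT, map_add] at hZW
  have hLR : It X - Z = W - It Y := by
    rw [sub_eq_sub_iff_add_eq_add, ← hZW, add_comm]
  have hL : It X - Z = 0 := by
    rw [← inner_self_eq_zero (𝕜 := ℝ)]
    nth_rewrite 2 [hLR]
    have f1 := crossT X hX W hW
    have f2 : ⟪It X, It Y⟫ = 0 := by
      rw [skew It hIt, sq It hIt, inner_neg_right, horth X hX Y hY]; simp
    have f3 := horth Z hZ W hW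
    have f4 : ⟪Z, It Y⟫ = 0 := by
      have := crossT Z hZ Y hY
      rw [skew It hIt] at this
      linarith
    simp [inner_sub_left, inner_sub_right, f1, f2, f3, f4]
  have hXm : It X ∈ U₁ := by rw [sub_eq_zero.1 hL]; exact hZ
  have hYm : It Y ∈ U₂ := by
    rw [hLR] at hL
    rw [← sub_eq_zero.1 hL]; exact hW
  have r1 : X ≠ 0 → It = I₁ ∨ It = -I₁ := fun h =>
    aux_pure I J K hII hJJ hKK hIJ hJI I₁ It hI₁ hIt U₁ hU₁' hpure₁ X hX h hXm
  have r2 : Y ≠ 0 → It = I₂ ∨ It = -I₂ := fun h =>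
    aux_pure I J K hII hJJ hKK hIJ hJI I₂ It hI₂ hIt U₂ hU₂' hpure₂ Y hY h hYm
  by_cases hX0 : X = 0
  · right
    refine ⟨r2 ?_, hX0⟩
    rintro rfl
    exact hT0 (by simp [hT, hX0])
  · by_cases hY0 : Y = 0
    · exact Or.inl ⟨r1 hX0, hY0⟩
    · exfalso
      rcases r1 hX0 with h | h <;> rcases r2 hY0 with h' | h'
      · exact hne (h'.symm.trans h)
      · exact hne' (by rw [← h, h', neg_neg])
      · exact hne' (h'.symm.trans h)
      · exact hne (neg_injective (h'.symm.trans h))
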